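/- arXiv:1907.02362 — 6 statements merged into one kernel-verified Lean document; each statement's English description precedes it below -/
import Mathlib

section
/- If the coefficients (α, γ|_B) are locally Lipschitz, then the transformed coefficients (a, c|_B), defined by a(ω,t,y) := U_{−t} ℓ α(ω, t, π U_t y) and c(ω,t,y,x) := U_{−t} ℓ γ(ω, t, π U_t y, x), are locally Lipschitz as well. -/
open MeasureTheory NNReal ENNReal

noncomputable section

/-- The pair of coefficients `(α, γ|_B)` is locally Lipschitz: ℙ-almost surely
`∫_B ‖γ(t,y,x)‖² F(dx) < ∞` for all `t ≥ 0` and `y`, and for each `n ∈ ℕ` there is a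
nondecreasing function `L_n : [0,∞) → [0,∞)` such that ℙ-almost surely
`‖α(t,y₁) − α(t,y₂)‖ ≤ L_n(t)‖y₁ − y₂‖` and
`(∫_B ‖γ(t,y₁,x) − γ(t,y₂,x)‖² F(dx))^{1/2} ≤ L_n(t)‖y₁ − y₂‖` for all `t ≥ 0` and all
`y₁, y₂` with `‖y₁‖, ‖y₂‖ ≤ n`. -/
def PairLocLip {Ω E H : Type*} [MeasurableSpace Ω] [MeasurableSpace E]
    [NormedAddCommGroup H]
    (P : Measure Ω) (F : Measure E) (B : Set E)
    (α : Ω → ℝ≥0 → H → H) (γ : Ω → ℝ≥0 → H → E → H) : Prop :=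
  (∀ᵐ ω ∂P, ∀ (t : ℝ≥0) (y : H), (∫⁻ x in B, ((‖γ ω t y x‖₊ : ℝ≥0∞)) ^ 2 ∂F) < ⊤) ∧
  ∀ n : ℕ, ∃ L : ℝ≥0 → ℝ≥0, Monotone L ∧
    ∀ᵐ ω ∂P, ∀ (t : ℝ≥0) (y₁ y₂ : H), ‖y₁‖ ≤ (n : ℝ) → ‖y₂‖ ≤ (n : ℝ) →
      ‖α ω t y₁ - α ω t y₂‖ ≤ (L t : ℝ) * ‖y₁ - y₂‖ ∧
      (∫⁻ x in B, ((‖γ ω t y₁ x - γ ω t y₂ x‖₊ : ℝ≥0∞)) ^ 2 ∂F) ^ (1 / 2 : ℝ)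
        ≤ ENNReal.ofReal ((L t : ℝ) * ‖y₁ - y₂‖)

/-- A strongly continuous family of operators is bounded on the intervals `[-t, t]` by a
nondecreasing function of `t`. -/
lemma exists_monotone_opNorm_bound {V : Type*} [NormedAddCommGroup V] [NormedSpace ℝ V]
    [CompleteSpace V] (U : ℝ → (V →L[ℝ] V)) (hU : ∀ x : V, Continuous fun t : ℝ => U t x) :
    ∃ M : ℝ≥0 → ℝ≥0, Monotone M ∧ ∀ (t : ℝ≥0) (s : ℝ), |s| ≤ t → ‖U s‖₊ ≤ M t := by
  have hbound : ∀ k : ℕ, ∃ C : ℝ≥0, ∀ s : ℝ, |s| ≤ k → ‖U s‖₊ ≤ C := by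
    intro k
    obtain ⟨C, hC⟩ := banach_steinhaus
      (g := fun s : Set.Icc (-(k : ℝ)) k => U s) (fun x => by
        obtain ⟨C, hC⟩ := (isCompact_Icc (a := -(k : ℝ)) (b := k)).exists_bound_of_continuousOn
          (hU x).continuousOn
        exact ⟨C, fun s => hC s s.2⟩)
    refine ⟨C.toNNReal, fun s hs => ?_⟩
    rw [← norm_toNNReal]
    exact Real.toNNReal_le_toNNReal (hC ⟨s, abs_le.mp hs⟩)
  choose C hC using hbound
  refine ⟨fun t => ∑ i ∈ Finset.range (⌈t⌉₊ + 1), C i, fun s t hst => ?_, fun t s hs => ?_⟩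
  · exact Finset.sum_le_sum_of_subset
      (Finset.range_mono (Nat.succ_le_succ (Nat.ceil_mono hst)))
  · refine (hC ⌈t⌉₊ s (hs.trans ?_)).trans
      (Finset.single_le_sum (f := C) (fun _ _ => zero_le) (Finset.self_mem_range_succ _))
    exact_mod_cast Nat.le_ceil t

lemma lintegral_nnnorm_sq_le_of_le_mul {E V W : Type*} [MeasurableSpace E]
    [NormedAddCommGroup V] [NormedAddCommGroup W] (μ : Measure E) {f : E → V} {g : E → W}
    {c : ℝ≥0} (h : ∀ x, ‖g x‖₊ ≤ c * ‖f x‖₊) :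
    ∫⁻ x, (‖g x‖₊ : ℝ≥0∞) ^ 2 ∂μ ≤ (c : ℝ≥0∞) ^ 2 * ∫⁻ x, (‖f x‖₊ : ℝ≥0∞) ^ 2 ∂μ := by
  rw [← lintegral_const_mul' _ _ (by finiteness)]
  refine lintegral_mono fun x => ?_
  rw [← mul_pow]
  gcongr
  exact_mod_cast h x

lemma sqrt_lintegral_nnnorm_sq_le_of_le_mul {E V W : Type*} [MeasurableSpace E]
    [NormedAddCommGroup V] [NormedAddCommGroup W] (μ : Measure E) {f : E → V} {g : E → W}
    {c : ℝ≥0} (h : ∀ x, ‖g x‖₊ ≤ c * ‖f x‖₊) :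
    (∫⁻ x, (‖g x‖₊ : ℝ≥0∞) ^ 2 ∂μ) ^ (1 / 2 : ℝ) ≤
      c * (∫⁻ x, (‖f x‖₊ : ℝ≥0∞) ^ 2 ∂μ) ^ (1 / 2 : ℝ) := by
  refine (ENNReal.rpow_le_rpow (lintegral_nnnorm_sq_le_of_le_mul μ h) (by norm_num)).trans ?_
  rw [ENNReal.mul_rpow_of_nonneg _ _ (by norm_num), ← ENNReal.rpow_natCast,
    ← ENNReal.rpow_mul]
  norm_num

/-- Lemma 4.3 (1) of the paper: if `(α, γ|_B)` are locally Lipschitz, then the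
transformed coefficients `a(ω,t,y) := U_{−t} ℓ α(ω,t,π U_t y)` and
`c(ω,t,y,x) := U_{−t} ℓ γ(ω,t,π U_t y,x)` are locally Lipschitz as well. -/
theorem transformed_coefficients_locally_lipschitz
    {Ω E H 𝓗 : Type*} [MeasurableSpace Ω] [MeasurableSpace E]
    [NormedAddCommGroup H] [InnerProductSpace ℝ H] [CompleteSpace H]
    [SecondCountableTopology H]
    [NormedAddCommGroup 𝓗] [InnerProductSpace ℝ 𝓗] [CompleteSpace 𝓗]
    [SecondCountableTopology 𝓗]
    (P : Measure Ω) [IsProbabilityMeasure P]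
    (F : Measure E) [SigmaFinite F] (B : Set E) (hB : MeasurableSet B)
    (U : ℝ → (𝓗 →L[ℝ] 𝓗))
    (hU0 : U 0 = ContinuousLinearMap.id ℝ 𝓗)
    (hUadd : ∀ s t : ℝ, U (s + t) = (U s).comp (U t))
    (hUcont : ∀ x : 𝓗, Continuous fun t : ℝ => U t x)
    (ℓ : H →L[ℝ] 𝓗) (π : 𝓗 →L[ℝ] H)
    (α : Ω → ℝ≥0 → H → H) (γ : Ω → ℝ≥0 → H → E → H)
    (h : PairLocLip P F B α γ) :
    PairLocLip P F B
      (fun ω t y => U (-(t : ℝ)) (ℓ (α ω t (π (U (t : ℝ) y)))))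
      (fun ω t y x => U (-(t : ℝ)) (ℓ (γ ω t (π (U (t : ℝ) y)) x))) := by
  obtain ⟨M, hMmono, hM⟩ := exists_monotone_opNorm_bound U hUcont
  obtain ⟨hfin, hlip⟩ := h
  choose L hLmono hL using hlip
  have hUℓ : ∀ (t : ℝ≥0) (v : H), ‖U (-(t : ℝ)) (ℓ v)‖₊ ≤ M t * ‖ℓ‖₊ * ‖v‖₊ := by
    intro t v
    calc ‖U (-(t : ℝ)) (ℓ v)‖₊ ≤ ‖U (-(t : ℝ))‖₊ * (‖ℓ‖₊ * ‖v‖₊) :=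
          ((U _).le_opNNNorm _).trans (by gcongr; exact ℓ.le_opNNNorm v)
      _ ≤ M t * (‖ℓ‖₊ * ‖v‖₊) := by
          gcongr
          exact hM t _ (by simp)
      _ = M t * ‖ℓ‖₊ * ‖v‖₊ := (mul_assoc _ _ _).symm
  have hπU : ∀ (t : ℝ≥0) (y : 𝓗), ‖π (U (t : ℝ) y)‖₊ ≤ ‖π‖₊ * M t * ‖y‖₊ := by
    intro t y
    calc ‖π (U (t : ℝ) y)‖₊ ≤ ‖π‖₊ * (‖U (t : ℝ)‖₊ * ‖y‖₊) :=
          (π.le_opNNNorm _).trans (by gcongr; exact (U _).le_opNNNorm y)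
      _ ≤ ‖π‖₊ * (M t * ‖y‖₊) := by
          gcongr
          exact hM t _ (by simp)
      _ = ‖π‖₊ * M t * ‖y‖₊ := (mul_assoc _ _ _).symm
  refine ⟨?_, fun n => ?_⟩
  · filter_upwards [hfin] with ω hω t y
    exact (lintegral_nnnorm_sq_le_of_le_mul _ fun x => hUℓ t _).trans_lt
      (ENNReal.mul_lt_top (by finiteness) (hω t _))
  · let N : ℝ≥0 → ℕ := fun t => ⌈‖π‖₊ * M t * n⌉₊
    have hN : Monotone N := fun s t hst => Nat.ceil_mono (by gcongr; exact hMmono hst)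
    let K : ℝ≥0 → ℝ≥0 := fun t => ∑ i ∈ Finset.range (N t + 1), L i t
    have hK : Monotone K := fun s t hst =>
      (Finset.sum_le_sum fun i _ => hLmono i hst).trans
        (Finset.sum_le_sum_of_subset (Finset.range_mono (Nat.succ_le_succ (hN hst))))
    have hLK : ∀ t, L (N t) t ≤ K t := fun t =>
      Finset.single_le_sum (f := fun i => L i t) (fun _ _ => zero_le)
        (Finset.self_mem_range_succ _)
    refine ⟨fun t => M t * ‖ℓ‖₊ * (K t * (‖π‖₊ * M t)), fun s t hst => ?_, ?_⟩
    · have h₁ := hMmono hst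
      have h₂ := hK hst
      dsimp only
      gcongr
    filter_upwards [ae_all_iff.mpr hL] with ω hω t y₁ y₂ hy₁ hy₂
    have hball : ∀ y : 𝓗, ‖y‖ ≤ n → ‖π (U (t : ℝ) y)‖ ≤ (N t : ℝ) := by
      intro y hy
      have h₁ : ‖y‖₊ ≤ (n : ℝ≥0) := by exact_mod_cast hy
      have h₂ : ‖π (U (t : ℝ) y)‖₊ ≤ (N t : ℝ≥0) :=
        (hπU t y).trans ((by gcongr : _ ≤ ‖π‖₊ * M t * n).trans (Nat.le_ceil _))
      exact_mod_cast h₂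
    obtain ⟨hα, hγ⟩ := hω (N t) t _ _ (hball y₁ hy₁) (hball y₂ hy₂)
    have hdiff : L (N t) t * ‖π (U (t : ℝ) y₁) - π (U (t : ℝ) y₂)‖₊ ≤
        K t * (‖π‖₊ * M t) * ‖y₁ - y₂‖₊ := by
      rw [← map_sub, ← map_sub, mul_assoc]
      exact mul_le_mul' (hLK t) (hπU t _)
    constructor
    · have h₁ : ‖α ω t (π (U (t : ℝ) y₁)) - α ω t (π (U (t : ℝ) y₂))‖₊ ≤
          K t * (‖π‖₊ * M t) * ‖y₁ - y₂‖₊ := le_trans (by exact_mod_cast hα) hdiff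
      have h₂ := (hUℓ t _).trans (mul_le_mul_right h₁ (M t * ‖ℓ‖₊))
      rw [map_sub, map_sub, ← mul_assoc] at h₂
      exact_mod_cast h₂
    · refine (sqrt_lintegral_nnnorm_sq_le_of_le_mul _ (c := M t * ‖ℓ‖₊)
        (f := fun x => γ ω t (π (U (t : ℝ) y₁)) x - γ ω t (π (U (t : ℝ) y₂)) x)
        fun x => ?_).trans ?_
      · rw [← map_sub, ← map_sub]
        exact hUℓ t _
      · have h₁ := hγ.trans (ENNReal.ofReal_le_ofReal (NNReal.coe_le_coe.mpr hdiff))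
        refine (mul_le_mul_right h₁ _).trans_eq ?_
        rw [← ENNReal.ofReal_coe_nnreal, ← ENNReal.ofReal_mul (NNReal.coe_nonneg _)]
        congr 1
        push_cast
        ring
end
end

section
/- If the coefficients (α, γ|_B) satisfy the linear growth condition, then the transformed coefficients (a, c|_B), defined by a(ω,t,y) := U_{−t} ℓ α(ω, t, π U_t y) and c(ω,t,y,x) := U_{−t} ℓ γ(ω, t, π U_t y, x), satisfy the linear growth condition as well. -/
open MeasureTheory NNReal ENNReal

noncomputable section

/-- The pair of coefficients `(α, γ|_B)` satisfies the linear growth condition: there is a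
nondecreasing function `K : [0,∞) → [0,∞)` such that ℙ-almost surely
`‖α(t,y)‖ ≤ K(t)(1 + ‖y‖)` and `(∫_B ‖γ(t,y,x)‖² F(dx))^{1/2} ≤ K(t)(1 + ‖y‖)` for all
`t ≥ 0` and all `y`. -/
def PairLinGrowth {Ω E H : Type*} [MeasurableSpace Ω] [MeasurableSpace E]
    [NormedAddCommGroup H]
    (P : Measure Ω) (F : Measure E) (B : Set E)
    (α : Ω → ℝ≥0 → H → H) (γ : Ω → ℝ≥0 → H → E → H) : Prop :=
  ∃ K : ℝ≥0 → ℝ≥0, Monotone K ∧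
    ∀ᵐ ω ∂P, ∀ (t : ℝ≥0) (y : H),
      ‖α ω t y‖ ≤ (K t : ℝ) * (1 + ‖y‖) ∧
      (∫⁻ x in B, ((‖γ ω t y x‖₊ : ℝ≥0∞)) ^ 2 ∂F) ^ (1 / 2 : ℝ)
        ≤ ENNReal.ofReal ((K t : ℝ) * (1 + ‖y‖))

/-- A family of operators that is strongly continuous on `ℝ` is bounded in operator norm on compact
intervals, with a bound that is monotone in the length of the interval. -/
theorem exists_monotone_bound_of_strongly_continuous {V W : Type*}
    [NormedAddCommGroup V] [NormedSpace ℝ V] [CompleteSpace V]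
    [NormedAddCommGroup W] [NormedSpace ℝ W]
    (U : ℝ → (V →L[ℝ] W)) (hU : ∀ x : V, Continuous fun t : ℝ => U t x) :
    ∃ M : ℝ≥0 → ℝ≥0, Monotone M ∧ ∀ (t : ℝ≥0) (s : ℝ), |s| ≤ t → ‖U s‖₊ ≤ M t := by
  have bdd (t : ℝ≥0) : BddAbove ((fun s => ‖U s‖₊) '' {s : ℝ | |s| ≤ t}) := by
    have hcompact : IsCompact {s : ℝ | |s| ≤ t} := by
      convert isCompact_Icc (a := -(t : ℝ)) (b := t) using 1
      exact Set.ext fun s => by simp [abs_le]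
    obtain ⟨C, hC⟩ := banach_steinhaus (g := fun s : {s : ℝ | |s| ≤ t} => U s) fun x => by
      obtain ⟨C, hC⟩ := hcompact.exists_bound_of_continuousOn (hU x).continuousOn
      exact ⟨C, fun s => hC s s.2⟩
    refine ⟨C.toNNReal, ?_⟩
    rintro _ ⟨s, hs, rfl⟩
    exact NNReal.le_toNNReal_of_coe_le (hC ⟨s, hs⟩)
  refine ⟨fun t => sSup ((fun s => ‖U s‖₊) '' {s : ℝ | |s| ≤ t}), fun t t' htt' => ?_,
    fun t s hs => le_csSup (bdd t) ⟨s, hs, rfl⟩⟩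
  refine csSup_le_csSup (bdd t') ⟨_, 0, by simp, rfl⟩ (Set.image_mono fun s hs => ?_)
  exact le_trans (show |s| ≤ t from hs) (NNReal.coe_le_coe.2 htt')

/-- The `L²` seminorm scales at most by `C` when the norm is scaled pointwise by at most `C`; no
measurability is needed. -/
theorem lintegral_nnnorm_sq_rpow_half_le {E V W : Type*} [MeasurableSpace E]
    [NormedAddCommGroup V] [NormedAddCommGroup W] (μ : Measure E) (f : E → V) (g : E → W)
    (C : ℝ≥0) (hgf : ∀ x, ‖g x‖₊ ≤ C * ‖f x‖₊) :
    (∫⁻ x, (‖g x‖₊ : ℝ≥0∞) ^ 2 ∂μ) ^ (1 / 2 : ℝ)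
      ≤ C * (∫⁻ x, (‖f x‖₊ : ℝ≥0∞) ^ 2 ∂μ) ^ (1 / 2 : ℝ) := by
  have hint : ∫⁻ x, (‖g x‖₊ : ℝ≥0∞) ^ 2 ∂μ ≤ (C : ℝ≥0∞) ^ 2 * ∫⁻ x, (‖f x‖₊ : ℝ≥0∞) ^ 2 ∂μ := by
    rw [← lintegral_const_mul' _ _ (by finiteness)]
    refine lintegral_mono fun x => ?_
    rw [← mul_pow]
    gcongr
    exact_mod_cast hgf x
  calc (∫⁻ x, (‖g x‖₊ : ℝ≥0∞) ^ 2 ∂μ) ^ (1 / 2 : ℝ)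
      ≤ ((C : ℝ≥0∞) ^ 2 * ∫⁻ x, (‖f x‖₊ : ℝ≥0∞) ^ 2 ∂μ) ^ (1 / 2 : ℝ) := by gcongr
    _ = C * (∫⁻ x, (‖f x‖₊ : ℝ≥0∞) ^ 2 ∂μ) ^ (1 / 2 : ℝ) := by
        rw [ENNReal.mul_rpow_of_nonneg _ _ (by norm_num), ← ENNReal.rpow_natCast,
          ← ENNReal.rpow_mul]
        norm_num

/-- Lemma 4.3 (2) of the paper: if `(α, γ|_B)` satisfy the linear growth condition, then
the transformed coefficients `a(ω,t,y) := U_{−t} ℓ α(ω,t,π U_t y)` and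
`c(ω,t,y,x) := U_{−t} ℓ γ(ω,t,π U_t y,x)` satisfy the linear growth condition as well. -/
theorem transformed_coefficients_linear_growth
    {Ω E H 𝓗 : Type*} [MeasurableSpace Ω] [MeasurableSpace E]
    [NormedAddCommGroup H] [InnerProductSpace ℝ H] [CompleteSpace H]
    [SecondCountableTopology H]
    [NormedAddCommGroup 𝓗] [InnerProductSpace ℝ 𝓗] [CompleteSpace 𝓗]
    [SecondCountableTopology 𝓗]
    (P : Measure Ω) [IsProbabilityMeasure P]
    (F : Measure E) [SigmaFinite F] (B : Set E) (hB : MeasurableSet B)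
    (U : ℝ → (𝓗 →L[ℝ] 𝓗))
    (hU0 : U 0 = ContinuousLinearMap.id ℝ 𝓗)
    (hUadd : ∀ s t : ℝ, U (s + t) = (U s).comp (U t))
    (hUcont : ∀ x : 𝓗, Continuous fun t : ℝ => U t x)
    (ℓ : H →L[ℝ] 𝓗) (π : 𝓗 →L[ℝ] H)
    (α : Ω → ℝ≥0 → H → H) (γ : Ω → ℝ≥0 → H → E → H)
    (h : PairLinGrowth P F B α γ) :
    PairLinGrowth P F B
      (fun ω t y => U (-(t : ℝ)) (ℓ (α ω t (π (U (t : ℝ) y)))))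
      (fun ω t y x => U (-(t : ℝ)) (ℓ (γ ω t (π (U (t : ℝ) y)) x))) := by
  obtain ⟨K, hK, hαγ⟩ := h
  obtain ⟨M, hM, hUM⟩ := exists_monotone_bound_of_strongly_continuous U hUcont
  refine ⟨fun t => M t * ‖ℓ‖₊ * (K t * (1 + ‖π‖₊ * M t)), fun s t hst => ?_, ?_⟩
  · have hMst := hM hst
    have hKst := hK hst
    dsimp only
    gcongr
  filter_upwards [hαγ] with ω hω t y
  obtain ⟨hα, hγ⟩ := hω t (π (U t y))
  have hout (z : H) : ‖U (-(t : ℝ)) (ℓ z)‖₊ ≤ M t * ‖ℓ‖₊ * ‖z‖₊ := by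
    calc ‖U (-(t : ℝ)) (ℓ z)‖₊ ≤ ‖U (-(t : ℝ))‖₊ * ‖ℓ z‖₊ := (U _).le_opNNNorm _
      _ ≤ M t * (‖ℓ‖₊ * ‖z‖₊) :=
          mul_le_mul' (hUM t _ (by simp)) (ℓ.le_opNNNorm z)
      _ = M t * ‖ℓ‖₊ * ‖z‖₊ := (mul_assoc _ _ _).symm
  have hin : ‖π (U t y)‖₊ ≤ ‖π‖₊ * M t * ‖y‖₊ := by
    calc ‖π (U t y)‖₊ ≤ ‖π‖₊ * (‖U t‖₊ * ‖y‖₊) :=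
          (π.le_opNNNorm _).trans (mul_le_mul_right ((U t).le_opNNNorm y) _)
      _ ≤ ‖π‖₊ * (M t * ‖y‖₊) := by
          gcongr
          exact hUM t t (by simp)
      _ = ‖π‖₊ * M t * ‖y‖₊ := (mul_assoc _ _ _).symm
  have hgrowth : (K t : ℝ) * (1 + ‖π (U t y)‖) ≤ K t * (1 + ‖π‖₊ * M t) * (1 + ‖y‖) := by
    have hin' : ‖π (U t y)‖ ≤ ‖π‖₊ * M t * ‖y‖ := mod_cast hin
    have hπM : (0 : ℝ) ≤ ‖π‖₊ * M t := by positivity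
    rw [mul_assoc]
    gcongr
    nlinarith [norm_nonneg y]
  have hbound : ((M t * ‖ℓ‖₊ : ℝ≥0) : ℝ) * (K t * (1 + ‖π (U t y)‖))
      ≤ (M t * ‖ℓ‖₊ * (K t * (1 + ‖π‖₊ * M t)) : ℝ≥0) * (1 + ‖y‖) := by
    rw [NNReal.coe_mul (M t * ‖ℓ‖₊), mul_assoc]
    push_cast at hgrowth ⊢
    gcongr
  refine ⟨?_, ?_⟩
  · calc ‖U (-(t : ℝ)) (ℓ (α ω t (π (U t y))))‖
        ≤ (M t * ‖ℓ‖₊ : ℝ≥0) * ‖α ω t (π (U t y))‖ := hout _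
      _ ≤ (M t * ‖ℓ‖₊ : ℝ≥0) * (K t * (1 + ‖π (U t y)‖)) := by gcongr
      _ ≤ _ := hbound
  · calc _ ≤ ((M t * ‖ℓ‖₊ : ℝ≥0) : ℝ≥0∞)
          * (∫⁻ x in B, (‖γ ω t (π (U t y)) x‖₊ : ℝ≥0∞) ^ 2 ∂F) ^ (1 / 2 : ℝ) :=
          lintegral_nnnorm_sq_rpow_half_le _ _ _ _ fun _ => hout _
      _ ≤ (M t * ‖ℓ‖₊ : ℝ≥0) * ENNReal.ofReal (K t * (1 + ‖π (U t y)‖)) := by gcongr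
      _ = ENNReal.ofReal ((M t * ‖ℓ‖₊ : ℝ≥0) * (K t * (1 + ‖π (U t y)‖))) := by
          rw [ENNReal.ofReal_mul (NNReal.coe_nonneg (M t * ‖ℓ‖₊)), ENNReal.ofReal_coe_nnreal]
      _ ≤ _ := ENNReal.ofReal_le_ofReal hbound
end
end

section
/- The derivative of ρ tends to infinity at the origin: the function u ↦ √(−log(u²)) − 1/√(−log(u²)) tends to +∞ as u → 0 from the right. Consequently, ρ is not Lipschitz continuous on any interval (0, η) with η > 0: for every L ≥ 0 and every η > 0 there exist u, v ∈ (0, η) with |ρ(u) − ρ(v)| > L·|u − v|. -/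
open Filter

noncomputable section

/-- The function `ρ` from Example 3.15 of the paper: `ρ(0) = 0`,
`ρ(u) = u·√(−log(u²))` for `0 < u < √δ`, and
`ρ(u) = √(−δ·log δ − (1 + log δ)(u² − δ))` for `u ≥ √δ`. -/
def rho (δ : ℝ) (u : ℝ) : ℝ :=
  if u = 0 then 0
  else if u < Real.sqrt δ then u * Real.sqrt (-Real.log (u ^ 2))
  else Real.sqrt (-δ * Real.log δ - (1 + Real.log δ) * (u ^ 2 - δ))

/-- `√(-log (u²))` tends to `+∞` as `u → 0⁺`. -/
theorem tendsto_sqrt_neg_log_sq :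
    Tendsto (fun u : ℝ => Real.sqrt (-Real.log (u ^ 2))) (nhdsWithin 0 (Set.Ioi 0)) atTop := by
  have h : Tendsto (fun u : ℝ => 2 * -Real.log u) (nhdsWithin 0 (Set.Ioi 0)) atTop :=
    (tendsto_neg_atBot_atTop.comp Real.tendsto_log_nhdsGT_zero).const_mul_atTop two_pos
  refine (Real.tendsto_sqrt_atTop.comp h).congr fun u => ?_
  simp [Real.log_pow]

/-- On `(0, √δ)` the function `ρ` is given by its logarithmic branch. -/
theorem rho_of_pos_of_lt {δ u : ℝ} (hu : 0 < u) (huδ : u < Real.sqrt δ) :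
    rho δ u = u * Real.sqrt (-Real.log (u ^ 2)) := by
  simp [rho, hu.ne', huδ]

theorem sqrt_neg_log_sq_sq (u : ℝ) :
    Real.sqrt (-Real.log ((u ^ 2) ^ 2)) = Real.sqrt 2 * Real.sqrt (-Real.log (u ^ 2)) := by
  rw [← Real.sqrt_mul zero_le_two, Real.log_pow (x := u ^ 2), Nat.cast_ofNat, mul_neg]

/-- The derivative of `ρ` tends to `+∞` at the origin: the function
`u ↦ √(−log(u²)) − 1/√(−log(u²))` tends to `+∞` as `u → 0⁺`. Consequently, `ρ` is not
Lipschitz continuous on any interval `(0, η)` with `η > 0`. -/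
theorem rho_deriv_tendsto_atTop_and_not_lipschitz (δ : ℝ) (hδ : 0 < δ)
    (hδ' : δ < Real.exp (-1)) :
    Tendsto (fun u : ℝ => Real.sqrt (-Real.log (u ^ 2)) - 1 / Real.sqrt (-Real.log (u ^ 2)))
      (nhdsWithin 0 (Set.Ioi 0)) atTop ∧
    ∀ L : ℝ, 0 ≤ L → ∀ η : ℝ, 0 < η →
      ∃ u v : ℝ, u ∈ Set.Ioo (0 : ℝ) η ∧ v ∈ Set.Ioo (0 : ℝ) η ∧
        L * |u - v| < |rho δ u - rho δ v| := by
  have hg := tendsto_sqrt_neg_log_sq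
  refine ⟨?_, fun L hL η hη => ?_⟩
  · have h0 : Tendsto (fun u : ℝ => -(1 / Real.sqrt (-Real.log (u ^ 2))))
        (nhdsWithin 0 (Set.Ioi 0)) (nhds (-0)) := by
      simpa only [one_div, Function.comp_def] using (tendsto_inv_atTop_zero.comp hg).neg
    simpa only [sub_eq_add_neg] using hg.atTop_add h0
  · have hpos : 0 < min η (min (Real.sqrt δ) (1 / 4)) :=
      lt_min hη (lt_min (Real.sqrt_pos.2 hδ) (by norm_num))
    obtain ⟨u, hgu, hu, hu'⟩ :=
      ((hg.eventually_gt_atTop (2 * L)).and (Ioo_mem_nhdsGT hpos)).exists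
    obtain ⟨huη, huδ, hu4⟩ : u < η ∧ u < Real.sqrt δ ∧ u < 1 / 4 := by
      simpa only [lt_min_iff] using hu'
    have hsq : u ^ 2 < u := by nlinarith
    have hsq0 : 0 < u ^ 2 := by positivity
    refine ⟨u, u ^ 2, ⟨hu, huη⟩, ⟨hsq0, hsq.trans huη⟩, ?_⟩
    rw [rho_of_pos_of_lt hu huδ, rho_of_pos_of_lt hsq0 (hsq.trans huδ), sqrt_neg_log_sq_sq,
      abs_of_pos (sub_pos.2 hsq)]
    refine lt_of_lt_of_le ?_ (le_abs_self _)
    set g := Real.sqrt (-Real.log (u ^ 2))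
    have h2 : Real.sqrt 2 ≤ 2 := Real.sqrt_le_iff.2 (by norm_num)
    have hfac : 1 / 2 ≤ 1 - u * Real.sqrt 2 := by nlinarith
    have hg0 : 0 ≤ g := Real.sqrt_nonneg _
    calc L * (u - u ^ 2) ≤ L * u := by gcongr; linarith
      _ < u * g * (1 / 2) := by nlinarith
      _ ≤ u * g * (1 - u * Real.sqrt 2) := by gcongr
      _ = u * g - u ^ 2 * (Real.sqrt 2 * g) := by ring
end
end

section
/- For every natural number n ≥ 1, the function a is Lipschitz continuous on the interval [−n, n] with Lipschitz constant n: |a(y₁) − a(y₂)| ≤ n·|y₁ − y₂| for all y₁, y₂ ∈ [−n, n]. In particular, a is locally Lipschitz on ℝ. -/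
/-- The function `a` from Example 3.16 of the paper. For `y ≥ 0` with `n = ⌊y⌋` one has
`a(y) = n` for `n ≤ y ≤ n + 1 − 1/(n+1)` and `a(y) = n + (n+1)(y − (n + 1 − 1/(n+1)))` for
`n + 1 − 1/(n+1) ≤ y ≤ n + 1`; for `y < 0` one sets `a(y) := a(−y)`. Equivalently, for
`y ≥ 0` with `n = ⌊y⌋`: `a(y) = n + max 0 ((n+1)(y − n) − n)`. -/
noncomputable def aFun (y : ℝ) : ℝ :=
  (⌊|y|⌋ : ℝ) + max 0 (((⌊|y|⌋ : ℝ) + 1) * (|y| - (⌊|y|⌋ : ℝ)) - (⌊|y|⌋ : ℝ))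

theorem aFun_of_nonneg {y : ℝ} (hy : 0 ≤ y) :
    aFun y = ⌊y⌋ + max 0 (((⌊y⌋ : ℝ) + 1) * (y - ⌊y⌋) - ⌊y⌋) := by
  rw [aFun, abs_of_nonneg hy]

theorem aFun_abs (y : ℝ) : aFun |y| = aFun y := by
  simp only [aFun, abs_abs]

theorem floor_le_aFun {y : ℝ} (hy : 0 ≤ y) : (⌊y⌋ : ℝ) ≤ aFun y := by
  rw [aFun_of_nonneg hy]
  exact le_add_of_nonneg_right (le_max_left _ _)

theorem aFun_le_floor_add_one {y : ℝ} (hy : 0 ≤ y) : aFun y ≤ ⌊y⌋ + 1 := by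
  have hk : (0 : ℝ) ≤ ⌊y⌋ := by exact_mod_cast Int.floor_nonneg.2 hy
  rw [aFun_of_nonneg hy, add_le_add_iff_left]
  exact max_le zero_le_one (by nlinarith [Int.lt_floor_add_one y])

/-- On an integer interval `[k, k + 1]` the graph of `aFun` lies above the line of slope
`k + 1` through `(k + 1, k + 1)`. -/
theorem floor_add_one_sub_aFun_le {y : ℝ} (hy : 0 ≤ y) :
    (⌊y⌋ : ℝ) + 1 - aFun y ≤ (⌊y⌋ + 1) * (⌊y⌋ + 1 - y) := by
  rw [aFun_of_nonneg hy]
  linarith [le_max_right 0 (((⌊y⌋ : ℝ) + 1) * (y - ⌊y⌋) - ⌊y⌋)]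

theorem aFun_sub_floor_le {n : ℕ} {y : ℝ} (hy : 0 ≤ y) (hyn : y ≤ n) :
    aFun y - ⌊y⌋ ≤ n * (y - ⌊y⌋) := by
  have hk : (0 : ℝ) ≤ ⌊y⌋ := by exact_mod_cast Int.floor_nonneg.2 hy
  have hfl := Int.floor_le y
  rw [aFun_of_nonneg hy, add_sub_cancel_left]
  refine max_le (mul_nonneg n.cast_nonneg (sub_nonneg.2 hfl)) ?_
  rcases hyn.eq_or_lt with rfl | hlt
  · simp
  · have hf : (⌊y⌋ : ℝ) + 1 ≤ n := by
      have : ⌊y⌋ < (n : ℤ) := Int.floor_lt.2 (by exact_mod_cast hlt)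
      exact_mod_cast this
    linarith [mul_le_mul_of_nonneg_right hf (sub_nonneg.2 hfl)]

theorem aFun_monotoneOn : MonotoneOn aFun (Set.Ici 0) := by
  intro x hx y hy hxy
  rcases (Int.floor_le_floor hxy).eq_or_lt with h | h
  · have hk : (0 : ℝ) ≤ ⌊y⌋ := by exact_mod_cast Int.floor_nonneg.2 hy
    rw [aFun_of_nonneg hx, aFun_of_nonneg hy, h]
    gcongr
  · have h' : (⌊x⌋ : ℝ) + 1 ≤ ⌊y⌋ := by exact_mod_cast h
    linarith [aFun_le_floor_add_one hx, floor_le_aFun hy]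

theorem aFun_sub_le {n : ℕ} {x y : ℝ} (hx : 0 ≤ x) (hxy : x ≤ y) (hyn : y ≤ n) :
    aFun y - aFun x ≤ n * (y - x) := by
  have hy := hx.trans hxy
  rcases hxy.eq_or_lt with rfl | hlt
  · simp
  have hf : (⌊x⌋ : ℝ) + 1 ≤ n := by
    have : ⌊x⌋ < (n : ℤ) := Int.floor_lt.2 (by exact_mod_cast hlt.trans_le hyn)
    exact_mod_cast this
  rcases (Int.floor_le_floor hxy).eq_or_lt with h | h
  · rw [aFun_of_nonneg hx, aFun_of_nonneg hy, ← h, add_sub_add_left_eq_sub]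
    have hmax := abs_max_sub_max_le_abs (((⌊x⌋ : ℝ) + 1) * (y - ⌊x⌋) - ⌊x⌋)
      (((⌊x⌋ : ℝ) + 1) * (x - ⌊x⌋) - ⌊x⌋) 0
    have hk : (0 : ℝ) ≤ ⌊x⌋ := by exact_mod_cast Int.floor_nonneg.2 hx
    have heq : ((⌊x⌋ : ℝ) + 1) * (y - ⌊x⌋) - ⌊x⌋ - (((⌊x⌋ : ℝ) + 1) * (x - ⌊x⌋) - ⌊x⌋) =
        (⌊x⌋ + 1) * (y - x) := by ring
    rw [heq, abs_of_nonneg (mul_nonneg (by linarith) (sub_nonneg.2 hxy))] at hmax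
    rw [max_comm 0, max_comm 0]
    exact (le_abs_self _).trans
      (hmax.trans (mul_le_mul_of_nonneg_right hf (sub_nonneg.2 hxy)))
  · have h' : (⌊x⌋ : ℝ) + 1 ≤ ⌊y⌋ := by exact_mod_cast h
    have hk : (0 : ℝ) ≤ ⌊x⌋ := by exact_mod_cast Int.floor_nonneg.2 hx
    have hright := aFun_sub_floor_le hy hyn
    have hleft := (floor_add_one_sub_aFun_le hx).trans
      (mul_le_mul_of_nonneg_right hf (sub_nonneg.2 (Int.lt_floor_add_one x).le))
    have hmid : (⌊y⌋ : ℝ) - (⌊x⌋ + 1) ≤ n * (⌊y⌋ - (⌊x⌋ + 1)) :=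
      le_mul_of_one_le_left (sub_nonneg.2 h') (by linarith)
    linarith

theorem abs_aFun_sub_aFun_le {n : ℕ} {x y : ℝ} (hx : |x| ≤ n) (hy : |y| ≤ n) :
    |aFun x - aFun y| ≤ n * |x - y| := by
  wlog hxy : |y| ≤ |x| generalizing x y
  · rw [abs_sub_comm, abs_sub_comm x]
    exact this hy hx (le_of_not_ge hxy)
  rw [← aFun_abs x, ← aFun_abs y, abs_of_nonneg
    (sub_nonneg.2 (aFun_monotoneOn (abs_nonneg y) (abs_nonneg x) hxy))]
  exact (aFun_sub_le (abs_nonneg y) hxy hx).trans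
    (mul_le_mul_of_nonneg_left (abs_sub_abs_le_abs_sub x y) n.cast_nonneg)

/-- For every natural number `n ≥ 1`, the function `a` is Lipschitz on `[−n, n]` with
Lipschitz constant `n`; in particular, `a` is locally Lipschitz on `ℝ`. -/
theorem aFun_lipschitzOn :
    (∀ n : ℕ, 1 ≤ n → ∀ y₁ ∈ Set.Icc (-(n : ℝ)) (n : ℝ), ∀ y₂ ∈ Set.Icc (-(n : ℝ)) (n : ℝ),
      |aFun y₁ - aFun y₂| ≤ (n : ℝ) * |y₁ - y₂|) ∧
    LocallyLipschitz aFun := by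
  refine ⟨fun n _ x hx y hy ↦ abs_aFun_sub_aFun_le (abs_le.2 hx) (abs_le.2 hy), fun x ↦ ?_⟩
  obtain ⟨n, hn⟩ := exists_nat_gt |x|
  refine ⟨n, Set.Icc (-(n : ℝ)) n, Icc_mem_nhds (abs_lt.1 hn).1 (abs_lt.1 hn).2,
    LipschitzOnWith.of_dist_le_mul fun y hy z hz ↦ ?_⟩
  simpa only [Real.dist_eq, NNReal.coe_natCast] using
    abs_aFun_sub_aFun_le (abs_le.2 hy) (abs_le.2 hz)
end

section
/- For every natural number n ≥ 1 and every real number p ≥ 2, there exist y₁, y₂ ∈ ℝ such that |y₁ − y₂| ≤ (1/n)^{1/p} and |a(y₁) − a(y₂)| = 1. -/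
/-- For every natural number `n ≥ 1` and every real `p ≥ 2`, there exist `y₁, y₂ ∈ ℝ`
with `|y₁ − y₂| ≤ (1/n)^{1/p}` and `|a(y₁) − a(y₂)| = 1`. -/
theorem aFun_jump (n : ℕ) (hn : 1 ≤ n) (p : ℝ) (hp : 2 ≤ p) :
    ∃ y₁ y₂ : ℝ, |y₁ - y₂| ≤ ((1 : ℝ) / n) ^ ((1 : ℝ) / p) ∧ |aFun y₁ - aFun y₂| = 1 := by
  have hn1 : (1 : ℝ) ≤ n := by exact_mod_cast hn
  have hinv0 : (0 : ℝ) < 1 / n := by positivity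
  have hinv1 : (1 : ℝ) / n ≤ 1 := by rw [div_le_one (by linarith)]; exact hn1
  refine ⟨n, n - 1 / n, ?_, ?_⟩
  · rw [sub_sub_cancel, abs_of_pos hinv0]
    refine Real.self_le_rpow_of_le_one hinv0.le hinv1 ?_
    rw [div_le_one (by linarith)]
    linarith
  · have hfloor : ⌊(n : ℝ) - 1 / n⌋ = (n : ℤ) - 1 := by
      rw [Int.floor_eq_iff]
      push_cast
      constructor <;> linarith
    have hright : aFun n = n := by simp [aFun]
    have hleft : aFun (n - 1 / n) = n - 1 := by
      have hslope : ((n : ℝ) - 1 + 1) * (n - 1 / n - (n - 1)) - (n - 1) = 0 := by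
        field_simp
        ring
      rw [aFun, abs_of_nonneg (by linarith), hfloor]
      push_cast
      rw [hslope, max_self, add_zero]
    rw [hright, hleft, sub_sub_cancel, abs_one]
end

section
/- Let p ≥ 2 be a real number and let κ : [0,∞) → [0,∞) be a nondecreasing function such that |a(y₁) − a(y₂)|^p ≤ κ(|y₁ − y₂|^p) for all y₁, y₂ ∈ ℝ. Then κ(u) ≥ 1 for every u ∈ (0, 1]. -/
theorem aFun_eq_floor_add {y : ℝ} {n : ℕ} (hy : (n : ℝ) ≤ y) (hy' : y < n + 1) :
    aFun y = n + max 0 (((n : ℝ) + 1) * (y - n) - n) := by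
  have h0 : 0 ≤ y := n.cast_nonneg.trans hy
  have hfloor : ⌊y⌋ = (n : ℤ) := by
    rw [Int.floor_eq_iff]
    exact ⟨by exact_mod_cast hy, by exact_mod_cast hy'⟩
  simp [aFun, abs_of_nonneg h0, hfloor]

theorem aFun_natCast (n : ℕ) : aFun n = n := by
  rw [aFun_eq_floor_add le_rfl (lt_add_one _)]
  simp

theorem aFun_natCast_add_one_sub (n : ℕ) : aFun (n + 1 - 1 / (n + 1)) = n := by
  have hpos : (0 : ℝ) < 1 / (n + 1) := Nat.one_div_pos_of_nat
  have hle : 1 / ((n : ℝ) + 1) ≤ 1 := by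
    rw [div_le_one (by positivity)]
    linarith [n.cast_nonneg (α := ℝ)]
  rw [aFun_eq_floor_add (n := n) (by rw [add_sub_assoc]; exact le_add_of_nonneg_right (sub_nonneg.2 hle))
    (sub_lt_self _ hpos)]
  have hzero : ((n : ℝ) + 1) * (n + 1 - 1 / (n + 1) - n) - n = 0 := by
    field_simp
    ring
  simp only [hzero, max_self, add_zero]

/-- If `p ≥ 2` and `κ : [0,∞) → [0,∞)` is nondecreasing with
`|a(y₁) − a(y₂)|^p ≤ κ(|y₁ − y₂|^p)` for all `y₁, y₂ ∈ ℝ`, then `κ(u) ≥ 1` for every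
`u ∈ (0, 1]`. -/
theorem kappa_ge_one (p : ℝ) (hp : 2 ≤ p) (κ : ℝ → ℝ)
    (hκnonneg : ∀ u : ℝ, 0 ≤ u → 0 ≤ κ u)
    (hκmono : MonotoneOn κ (Set.Ici 0))
    (h : ∀ y₁ y₂ : ℝ, |aFun y₁ - aFun y₂| ^ p ≤ κ (|y₁ - y₂| ^ p)) :
    ∀ u ∈ Set.Ioc (0 : ℝ) 1, 1 ≤ κ u := by
  intro u hu
  obtain ⟨n, hn⟩ := exists_nat_one_div_lt hu.1
  have hpos : (0 : ℝ) < 1 / (n + 1) := Nat.one_div_pos_of_nat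
  have hpow : (1 / ((n : ℝ) + 1)) ^ p ≤ u :=
    (Real.rpow_le_self_of_le_one hpos.le (hn.le.trans hu.2) (by linarith)).trans hn.le
  have hκ := h ((n + 1 : ℕ) : ℝ) (n + 1 - 1 / (n + 1))
  rw [aFun_natCast, aFun_natCast_add_one_sub, Nat.cast_add_one, add_sub_cancel_left,
    sub_sub_cancel, abs_one, Real.one_rpow, abs_of_pos hpos] at hκ
  exact hκ.trans (hκmono (Real.rpow_nonneg hpos.le p) hu.1.le hpow)
end
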